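/- arXiv:2406.06905 — 3 statements merged into one kernel-verified Lean document; each statement's English description precedes it below -/
import Mathlib

section
/- Let d ≥ 3 and p ∈ (1,10/9). There exists a constant C = C(d,p) such that for all t ≥ 0 and all x ∈ ℝ^d, I_t(x) ≤ C · ( |x|^{2 − d/p} ∧ 1 ). -/
open MeasureTheory ProbabilityTheory Set
open scoped ENNReal NNReal

noncomputable section

/-- Gaussian heat kernel on `ℝ^d` at time `t`, evaluated at displacement `z`:
`p_t(x,y) = gaussKer d t (y - x)`. -/
noncomputable def gaussKer (d : ℕ) (t : ℝ) (z : EuclideanSpace ℝ (Fin d)) : ℝ :=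
  (2 * Real.pi * t) ^ (-(d : ℝ) / 2) * Real.exp (-‖z‖ ^ 2 / (2 * t))

/-- `Q̃(t,x) = ∫₀ᵗ ( ∫_{|y| ≤ K} p_s(x,y) dy )^{1/p} ds`. -/
noncomputable def Qtilde (d : ℕ) (p K : ℝ) (t : ℝ) (x : EuclideanSpace ℝ (Fin d)) : ℝ :=
  ∫ s in Ioc (0 : ℝ) t,
    (∫ y in Metric.closedBall (0 : EuclideanSpace ℝ (Fin d)) K, gaussKer d s (y - x)) ^ (1 / p)

/-- `I_t(x) = min{1, ∫₀ᵗ s^{d/2 − d/(2p)} p_{8s}(x) ds}`. -/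
noncomputable def Ifun (d : ℕ) (p : ℝ) (t : ℝ) (x : EuclideanSpace ℝ (Fin d)) : ℝ :=
  min 1 (∫ s in Ioc (0 : ℝ) t, s ^ ((d : ℝ) / 2 - (d : ℝ) / (2 * p)) * gaussKer d (8 * s) x)


/-- The substitution `y = 1 / s` turns `∫ s ^ (-a) * exp (-b / s)` into a Gamma integral. -/
theorem integrableOn_rpow_neg_mul_exp_neg_div {a b : ℝ} (ha : 1 < a) (hb : 0 < b) :
    IntegrableOn (fun s : ℝ => s ^ (-a) * Real.exp (-b / s)) (Ioi 0) ∧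
      ∫ s in Ioi (0 : ℝ), s ^ (-a) * Real.exp (-b / s) =
        (1 / b) ^ (a - 1) * Real.Gamma (a - 1) := by
  have key : EqOn (fun s : ℝ => (|(-1 : ℝ)| * s ^ ((-1 : ℝ) - 1)) •
      (fun y : ℝ => y ^ (a - 1 - 1) * Real.exp (-(b * y))) (s ^ (-1 : ℝ)))
      (fun s : ℝ => s ^ (-a) * Real.exp (-b / s)) (Ioi 0) := by
    intro s hs
    have hs : 0 < s := hs
    have hexp : -(b * s ^ (-1 : ℝ)) = -b / s := by
      rw [Real.rpow_neg_one]; ring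
    simp only [smul_eq_mul, abs_neg, abs_one, one_mul]
    rw [hexp, ← mul_assoc, ← Real.rpow_mul hs.le, ← Real.rpow_add hs]
    ring_nf
  have hint : IntegrableOn (fun y : ℝ => y ^ (a - 1 - 1) * Real.exp (-(b * y))) (Ioi 0) := by
    simpa using integrableOn_rpow_mul_exp_neg_mul_rpow (p := 1) (s := a - 1 - 1) (by linarith)
      one_pos hb
  constructor
  · exact ((integrableOn_Ioi_comp_rpow_iff _ (by norm_num : (-1 : ℝ) ≠ 0)).2 hint).congr_fun
      key measurableSet_Ioi
  · rw [← setIntegral_congr_fun measurableSet_Ioi key,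
      integral_comp_rpow_Ioi (fun y : ℝ => y ^ (a - 1 - 1) * Real.exp (-(b * y)))
        (by norm_num : (-1 : ℝ) ≠ 0),
      Real.integral_rpow_mul_exp_neg_mul_Ioi (by linarith) hb]

/-- The power of `s` in the Gaussian kernel at time `8 * s` combines with the weight. -/
theorem rpow_mul_gaussKer (d : ℕ) (p : ℝ) {s : ℝ} (hs : 0 < s) (x : EuclideanSpace ℝ (Fin d)) :
    s ^ ((d : ℝ) / 2 - (d : ℝ) / (2 * p)) * gaussKer d (8 * s) x =
      (16 * Real.pi) ^ (-(d : ℝ) / 2) *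
        (s ^ (-((d : ℝ) / (2 * p))) * Real.exp (-(‖x‖ ^ 2 / 16) / s)) := by
  have hexp : -‖x‖ ^ 2 / (2 * (8 * s)) = -(‖x‖ ^ 2 / 16) / s := by
    field_simp
    ring
  have hpow : s ^ (-((d : ℝ) / (2 * p))) =
      s ^ ((d : ℝ) / 2 - (d : ℝ) / (2 * p)) * s ^ (-(d : ℝ) / 2) := by
    rw [← Real.rpow_add hs]
    ring_nf
  rw [gaussKer, hexp, hpow, show 2 * Real.pi * (8 * s) = 16 * Real.pi * s by ring,
    Real.mul_rpow (by positivity) hs.le]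
  ring

/-- The time integral defining `Ifun` is at most a constant times `‖x‖ ^ (2 - d / p)`. -/
theorem setIntegral_rpow_mul_gaussKer_le (d : ℕ) {p : ℝ} (hdp : 1 < (d : ℝ) / (2 * p)) (t : ℝ)
    {x : EuclideanSpace ℝ (Fin d)} (hx : x ≠ 0) :
    ∫ s in Ioc (0 : ℝ) t, s ^ ((d : ℝ) / 2 - (d : ℝ) / (2 * p)) * gaussKer d (8 * s) x ≤
      (16 * Real.pi) ^ (-(d : ℝ) / 2) * ((16 : ℝ) ^ ((d : ℝ) / (2 * p) - 1) *
        Real.Gamma ((d : ℝ) / (2 * p) - 1)) * ‖x‖ ^ (2 - (d : ℝ) / p) := by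
  have hr : 0 < ‖x‖ := norm_pos_iff.2 hx
  obtain ⟨hint, heq⟩ := integrableOn_rpow_neg_mul_exp_neg_div hdp
    (by positivity : 0 < ‖x‖ ^ 2 / 16)
  have hscale : (1 / (‖x‖ ^ 2 / 16)) ^ ((d : ℝ) / (2 * p) - 1) =
      (16 : ℝ) ^ ((d : ℝ) / (2 * p) - 1) * ‖x‖ ^ (2 - (d : ℝ) / p) := by
    rw [one_div_div, Real.div_rpow (by norm_num) (by positivity), div_eq_mul_inv,
      ← Real.rpow_natCast, ← Real.rpow_mul hr.le, ← Real.rpow_neg hr.le]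
    congr 2
    push_cast
    ring
  rw [setIntegral_congr_fun measurableSet_Ioc
    (fun s hs => rpow_mul_gaussKer d p (mem_Ioc.1 hs).1 x), integral_const_mul]
  calc _ ≤ (16 * Real.pi) ^ (-(d : ℝ) / 2) * ∫ s in Ioi (0 : ℝ),
        s ^ (-((d : ℝ) / (2 * p))) * Real.exp (-(‖x‖ ^ 2 / 16) / s) := by
        refine mul_le_mul_of_nonneg_left (setIntegral_mono_set hint ?_
          (Ioc_subset_Ioi_self.eventuallyLE)) (by positivity)
        filter_upwards [ae_restrict_mem measurableSet_Ioi] with s hs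
        have hs : 0 < s := hs
        simp only [Pi.zero_apply]
        positivity
    _ = _ := by
        rw [heq, hscale]
        ring

/-- for d ≥ 3, p ∈ (1,10/9), there is C = C(d,p) with
I_t(x) ≤ C · (|x|^{2−d/p} ∧ 1) for all t ≥ 0 and x (with the convention
0^{2−d/p} = ∞, encoded in ℝ≥0∞). -/
theorem Ifun_le_pow (d : ℕ) (hd : 3 ≤ d) (p : ℝ) (hp1 : 1 < p) (hp2 : p < 10 / 9) :
    ∃ C : ℝ, ∀ t : ℝ, 0 ≤ t → ∀ x : EuclideanSpace ℝ (Fin d),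
      ENNReal.ofReal (Ifun d p t x) ≤
        ENNReal.ofReal C * min ((‖x‖₊ : ℝ≥0∞) ^ (2 - (d : ℝ) / p)) 1 := by
  have hp0 : 0 < p := by linarith
  have hd' : (3 : ℝ) ≤ d := by exact_mod_cast hd
  have hdp : 1 < (d : ℝ) / (2 * p) := by
    rw [lt_div_iff₀ (by positivity)]
    linarith
  set K : ℝ := (16 * Real.pi) ^ (-(d : ℝ) / 2) * ((16 : ℝ) ^ ((d : ℝ) / (2 * p) - 1) *
    Real.Gamma ((d : ℝ) / (2 * p) - 1))
  refine ⟨max 1 K, fun t _ x => ?_⟩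
  have hone : ENNReal.ofReal (Ifun d p t x) ≤ ENNReal.ofReal (max 1 K) :=
    ENNReal.ofReal_le_ofReal ((min_le_left _ _).trans (le_max_left _ _))
  rcases eq_or_ne x 0 with rfl | hx
  · have hneg : 2 - (d : ℝ) / p < 0 := by
      rw [sub_neg, lt_div_iff₀ hp0]
      linarith
    simpa [ENNReal.zero_rpow_of_neg hneg] using hone
  · have hr : 0 < ‖x‖ := norm_pos_iff.2 hx
    rcases min_choice ((‖x‖₊ : ℝ≥0∞) ^ (2 - (d : ℝ) / p)) 1 with h | h
    · rw [h, ← enorm_eq_nnnorm, ← ofReal_norm, ENNReal.ofReal_rpow_of_pos hr,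
        ← ENNReal.ofReal_mul (by positivity)]
      refine ENNReal.ofReal_le_ofReal ((min_le_right _ _).trans
        ((setIntegral_rpow_mul_gaussKer_le d hdp t hx).trans ?_))
      exact mul_le_mul_of_nonneg_right (le_max_right _ _) (by positivity)
    · rwa [h, mul_one]
end
end

section
/- Let d ≥ 3, α > 2 and 2 < γ < min(d, α, 4). There exists p₀ = p₀(d,α,γ) ∈ (1, 10/9] such that for every p ∈ (1, p₀) there is a constant C = C(d,α,γ,p) with the following property: for every Borel measurable g : ℝ^d × ℝ^d → [0,∞) with g(x,y) ≤ |x−y|^{−α} ∧ 1 for all x,y, one has ∫_{ℝ^d} ∫_{ℝ^d} I_t(x) · I_t(y) · g(x,y) dx dy ≤ C · t^{2 + d − d/p − γ/2} for all t ≥ 1. -/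
open MeasureTheory ProbabilityTheory Set
open scoped ENNReal NNReal

noncomputable section

local notation "ES" d => EuclideanSpace ℝ (Fin d)

lemma lintegral_ball_enorm_rpow_neg_le (d : ℕ) (γ : ℝ) (hγ0 : 0 < γ) (hγ : γ < d) {R : ℝ}
    (hR : 0 < R) :
    ∫⁻ z : ES d, (Metric.ball 0 R).indicator (fun z ↦ ‖z‖ₑ ^ (-γ)) z ≤
      ENNReal.ofReal (d * volume.real (Metric.ball (0 : ES d) 1) / (d - γ) *
        R ^ ((d : ℝ) - γ)) := by
  have hd : 0 < (d : ℝ) := hγ0.trans hγ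
  have hd1 : 1 ≤ d := by exact_mod_cast hd
  have : Nonempty (Fin d) := ⟨⟨0, hd1⟩⟩
  have hexp : -1 < (d : ℝ) - 1 - γ := by linarith
  let f : ℝ → ℝ := (Iio R).indicator fun r ↦ r ^ (-γ)
  have hprod : EqOn (fun y : ℝ ↦ y ^ (Module.finrank ℝ (ES d) - 1) • f y)
      ((Iio R).indicator fun y ↦ y ^ ((d : ℝ) - 1 - γ)) (Ioi 0) := by
    intro y (hy : 0 < y)
    by_cases hyR : y < R
    · simp only [f, finrank_euclideanSpace, Fintype.card_fin, smul_eq_mul,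
        indicator_of_mem (mem_Iio.2 hyR)]
      rw [← Real.rpow_natCast, ← Real.rpow_add hy, Nat.cast_sub hd1]
      ring_nf
    · simp [f, hyR]
  have hset : Ioi (0 : ℝ) ∩ Iio R = Ioo 0 R := rfl
  have hint : Integrable (fun z : ES d ↦ f ‖z‖) := by
    rw [integrable_fun_norm_addHaar volume (f := f), integrableOn_congr_fun hprod measurableSet_Ioi,
      integrableOn_indicator_iff measurableSet_Iio, inter_comm, hset,
      ← intervalIntegrable_iff_integrableOn_Ioo_of_le hR.le]
    exact intervalIntegral.intervalIntegrable_rpow' hexp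
  have hval : ∫ z : ES d, f ‖z‖ =
      d * volume.real (Metric.ball (0 : ES d) 1) / (d - γ) * R ^ ((d : ℝ) - γ) := by
    rw [integral_fun_norm_addHaar volume f, setIntegral_congr_fun measurableSet_Ioi hprod,
      setIntegral_indicator measurableSet_Iio, hset, ← integral_Ioc_eq_integral_Ioo,
      ← intervalIntegral.integral_of_le hR.le, integral_rpow (Or.inl hexp)]
    have h1 : (d : ℝ) - 1 - γ + 1 = d - γ := by ring
    rw [h1, Real.zero_rpow (by linarith)]
    simp only [finrank_euclideanSpace, Fintype.card_fin, smul_eq_mul, nsmul_eq_mul]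
    ring
  have hf0 : ∀ z : ES d, 0 ≤ f ‖z‖ := fun z ↦
    indicator_apply_nonneg fun _ ↦ by positivity
  rw [← hval, ofReal_integral_eq_lintegral_ofReal hint (Filter.Eventually.of_forall hf0)]
  refine lintegral_mono_ae ?_
  filter_upwards [Measure.ae_ne volume (0 : ES d)] with z hz
  by_cases hzR : ‖z‖ < R
  · rw [indicator_of_mem (by simpa using hzR)]
    simp only [f, indicator_of_mem (mem_Iio.2 hzR)]
    rw [← ENNReal.ofReal_rpow_of_pos (norm_pos_iff.2 hz), ofReal_norm]
  · rw [indicator_of_notMem (by simpa using hzR)]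
    exact zero_le

lemma gaussKer_nonneg (d : ℕ) {t : ℝ} (ht : 0 ≤ t) (z : ES d) : 0 ≤ gaussKer d t z := by
  unfold gaussKer
  positivity

lemma measurable_gaussKer (d : ℕ) :
    Measurable fun q : ℝ × ES d ↦ gaussKer d q.1 q.2 := by
  unfold gaussKer
  fun_prop

lemma lintegral_gaussKer (d : ℕ) {t : ℝ} (ht : 0 < t) :
    ∫⁻ z : ES d, ENNReal.ofReal (gaussKer d t z) = 1 := by
  have hb : 0 < (2 * t)⁻¹ := by positivity
  have hrw : ∀ z : ES d, gaussKer d t z =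
      (2 * Real.pi * t) ^ (-(d : ℝ) / 2) * Real.exp (-(2 * t)⁻¹ * ‖z‖ ^ 2) := by
    intro z
    unfold gaussKer
    congr 2
    field_simp
  have hval : ∫ z : ES d, gaussKer d t z = 1 := by
    simp_rw [hrw]
    rw [integral_const_mul, GaussianFourier.integral_rexp_neg_mul_sq_norm hb]
    simp only [finrank_euclideanSpace, Fintype.card_fin]
    have h : Real.pi / (2 * t)⁻¹ = 2 * Real.pi * t := by field_simp
    rw [h, ← Real.rpow_add (by positivity)]
    ring_nf
    simp
  have hint : Integrable (fun z : ES d ↦ gaussKer d t z) := by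
    by_contra h
    rw [integral_undef h] at hval
    exact zero_ne_one hval
  rw [← ofReal_integral_eq_lintegral_ofReal hint
    (Filter.Eventually.of_forall (gaussKer_nonneg d ht.le)), hval, ENNReal.ofReal_one]

lemma gaussKer_le (d : ℕ) {s : ℝ} (hs : 0 < s) (z : ES d) :
    gaussKer d (8 * s) z ≤ s ^ (-(d : ℝ) / 2) := by
  unfold gaussKer
  have h1 : (2 * Real.pi * (8 * s)) ^ (-(d : ℝ) / 2) ≤ s ^ (-(d : ℝ) / 2) := by
    apply Real.rpow_le_rpow_of_nonpos hs
    · nlinarith [Real.pi_gt_three]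
    · have : (0 : ℝ) ≤ d := by positivity
      linarith
  have h2 : Real.exp (-‖z‖ ^ 2 / (2 * (8 * s))) ≤ 1 := by
    rw [Real.exp_le_one_iff]
    exact div_nonpos_of_nonpos_of_nonneg (by nlinarith [sq_nonneg ‖z‖]) (by positivity)
  calc _ ≤ s ^ (-(d : ℝ) / 2) * 1 := by gcongr
    _ = _ := mul_one _

/-- The Riesz potential of the heat kernel at time `8 * s` is at most of order `s ^ (-γ / 2)`. -/
lemma exists_lintegral_gaussKer_mul_enorm_rpow_le (d : ℕ) (γ : ℝ) (hγ0 : 0 < γ) (hγ : γ < d) :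
    ∃ C : ℝ, 0 ≤ C ∧ ∀ s : ℝ, 0 < s → ∀ y : ES d,
      ∫⁻ x : ES d, ENNReal.ofReal (gaussKer d (8 * s) x) * ‖x - y‖ₑ ^ (-γ) ≤
        ENNReal.ofReal (C * s ^ (-γ / 2)) := by
  set K : ℝ := d * volume.real (Metric.ball (0 : ES d) 1) / (d - γ) with hK
  have hK0 : 0 ≤ K := div_nonneg (by positivity) (by linarith)
  refine ⟨1 + K, by positivity, fun s hs y ↦ ?_⟩
  have hsq : 0 < √s := Real.sqrt_pos.2 hs
  have hrad : √s ^ (-γ) = s ^ (-γ / 2) := by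
    rw [Real.sqrt_eq_rpow, ← Real.rpow_mul hs.le]
    ring_nf
  let h : (ES d) → ℝ≥0∞ := (Metric.ball 0 √s).indicator fun z ↦ ‖z‖ₑ ^ (-γ)
  have hh : Measurable h := by
    apply Measurable.indicator _ measurableSet_ball
    fun_prop
  have hpt : ∀ x : ES d, ENNReal.ofReal (gaussKer d (8 * s) x) * ‖x - y‖ₑ ^ (-γ) ≤
      ENNReal.ofReal (gaussKer d (8 * s) x) * ENNReal.ofReal (s ^ (-γ / 2)) +
        ENNReal.ofReal (s ^ (-(d : ℝ) / 2)) * h (x - y) := by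
    intro x
    by_cases hx : ‖x - y‖ < √s
    · refine le_add_left ?_
      simp only [h]
      rw [indicator_of_mem (by simpa using hx)]
      gcongr
      exact gaussKer_le d hs x
    · refine le_add_right ?_
      gcongr
      push Not at hx
      rw [← hrad, ← ENNReal.ofReal_rpow_of_pos hsq, ← ofReal_norm,
        ENNReal.rpow_neg, ENNReal.rpow_neg]
      gcongr
  have hmeas : Measurable fun x : ES d ↦ ENNReal.ofReal (gaussKer d (8 * s) x) :=
    ((measurable_gaussKer d).comp (measurable_const.prodMk measurable_id)).ennreal_ofReal
  calc _ ≤ ∫⁻ x : ES d, (ENNReal.ofReal (gaussKer d (8 * s) x) * ENNReal.ofReal (s ^ (-γ / 2)) +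
        ENNReal.ofReal (s ^ (-(d : ℝ) / 2)) * h (x - y)) := lintegral_mono hpt
    _ = ENNReal.ofReal (s ^ (-γ / 2)) +
        ENNReal.ofReal (s ^ (-(d : ℝ) / 2)) * ∫⁻ z, h z := by
      rw [lintegral_add_left (by fun_prop), lintegral_mul_const _ hmeas,
        lintegral_gaussKer d (by positivity), one_mul, lintegral_const_mul _ (by fun_prop),
        lintegral_sub_right_eq_self]
    _ ≤ ENNReal.ofReal (s ^ (-γ / 2)) +
        ENNReal.ofReal (s ^ (-(d : ℝ) / 2)) * ENNReal.ofReal (K * √s ^ ((d : ℝ) - γ)) := by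
      gcongr
      exact lintegral_ball_enorm_rpow_neg_le d γ hγ0 hγ hsq
    _ = _ := by
      rw [← ENNReal.ofReal_mul (by positivity), ← ENNReal.ofReal_add (by positivity)
        (by positivity), Real.sqrt_eq_rpow, ← Real.rpow_mul hs.le, mul_left_comm,
        ← Real.rpow_add hs]
      ring_nf

lemma lintegral_mul_lintegral_swap {X Y : Type*} [MeasurableSpace X] [MeasurableSpace Y]
    {μ : Measure X} {ν : Measure Y} [SFinite μ] [SFinite ν] {w : X → ℝ≥0∞} {r : Y → ℝ≥0∞}
    {k : X → Y → ℝ≥0∞} (hw : Measurable w) (hr : Measurable r)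
    (hk : Measurable (Function.uncurry k)) :
    ∫⁻ y, r y * ∫⁻ x, w x * k x y ∂μ ∂ν = ∫⁻ x, w x * ∫⁻ y, r y * k x y ∂ν ∂μ := by
  have hky : ∀ y, Measurable fun x ↦ w x * k x y := fun y ↦
    hw.mul (hk.comp (measurable_id.prodMk measurable_const))
  have hkx : ∀ x, Measurable fun y ↦ r y * k x y := fun x ↦
    hr.mul (hk.comp (measurable_const.prodMk measurable_id))
  calc _ = ∫⁻ y, ∫⁻ x, r y * (w x * k x y) ∂μ ∂ν :=
        lintegral_congr fun y ↦ (lintegral_const_mul (r y) (hky y)).symm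
    _ = ∫⁻ x, ∫⁻ y, r y * (w x * k x y) ∂ν ∂μ :=
        lintegral_lintegral_swap ((hr.comp measurable_fst).mul
          ((hw.comp measurable_snd).mul (hk.comp measurable_swap))).aemeasurable
    _ = ∫⁻ x, ∫⁻ y, w x * (r y * k x y) ∂ν ∂μ := by simp_rw [mul_left_comm]
    _ = _ := lintegral_congr fun x ↦ lintegral_const_mul (w x) (hkx x)

/-- The defining integral of `Ifun`, without the cutoff and with values in `ℝ≥0∞`. -/
def heatPotential (d : ℕ) (δ t : ℝ) (x : ES d) : ℝ≥0∞ :=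
  ∫⁻ s in Ioc (0 : ℝ) t, ENNReal.ofReal (s ^ δ) * ENNReal.ofReal (gaussKer d (8 * s) x)

lemma measurable_ofReal_gaussKer (d : ℕ) :
    Measurable fun q : ℝ × ES d ↦ ENNReal.ofReal (gaussKer d (8 * q.1) q.2) :=
  ((measurable_gaussKer d).comp
    ((measurable_fst.const_mul 8).prodMk measurable_snd)).ennreal_ofReal

lemma measurable_heatPotential (d : ℕ) (δ t : ℝ) : Measurable (heatPotential d δ t) := by
  unfold heatPotential
  refine Measurable.lintegral_prod_left' (f := fun q : ℝ × ES d ↦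
    ENNReal.ofReal (q.1 ^ δ) * ENNReal.ofReal (gaussKer d (8 * q.1) q.2)) ?_
  exact Measurable.mul (by fun_prop) (measurable_ofReal_gaussKer d)

lemma ofReal_Ifun_le (d : ℕ) (p t : ℝ) (x : ES d) :
    ENNReal.ofReal (Ifun d p t x) ≤ heatPotential d ((d : ℝ) / 2 - d / (2 * p)) t x := by
  set δ : ℝ := (d : ℝ) / 2 - d / (2 * p) with hδ
  have hm : Measurable fun s : ℝ ↦ s ^ δ * gaussKer d (8 * s) x :=
    Measurable.mul (by fun_prop)
      ((measurable_gaussKer d).comp ((measurable_id.const_mul 8).prodMk measurable_const))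
  have hnn : ∀ s ∈ Ioc (0 : ℝ) t, 0 ≤ s ^ δ * gaussKer d (8 * s) x := fun s hs ↦
    mul_nonneg (Real.rpow_nonneg hs.1.le _) (gaussKer_nonneg d (by linarith [hs.1]) x)
  refine (ENNReal.ofReal_le_ofReal (min_le_right _ _)).trans ?_
  rw [integral_eq_lintegral_of_nonneg_ae
    (ae_restrict_of_forall_mem measurableSet_Ioc hnn) hm.aestronglyMeasurable]
  refine ENNReal.ofReal_toReal_le.trans ?_
  refine setLIntegral_mono_ae' measurableSet_Ioc (Filter.Eventually.of_forall fun s hs ↦ ?_)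
  rw [ENNReal.ofReal_mul (Real.rpow_nonneg hs.1.le _)]

lemma lintegral_heatPotential_mul (d : ℕ) (δ t : ℝ) {f : (ES d) → ℝ≥0∞} (hf : Measurable f) :
    ∫⁻ x, heatPotential d δ t x * f x = ∫⁻ s in Ioc (0 : ℝ) t, ENNReal.ofReal (s ^ δ) *
      ∫⁻ x, ENNReal.ofReal (gaussKer d (8 * s) x) * f x := by
  simp_rw [heatPotential, mul_comm _ (f _)]
  exact lintegral_mul_lintegral_swap (by fun_prop) hf (measurable_ofReal_gaussKer d)

lemma min_rpow_neg_le (α γ : ℝ) (hγ0 : 0 < γ) (hγα : γ ≤ α) (a : ℝ≥0∞) :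
    min (a ^ (-α)) 1 ≤ a ^ (-γ) := by
  rcases le_total 1 a with h | h
  · exact (min_le_left _ _).trans (ENNReal.rpow_le_rpow_of_exponent_le h (by linarith))
  · refine (min_le_right _ _).trans ?_
    rw [ENNReal.rpow_neg, ENNReal.one_le_inv]
    exact ENNReal.rpow_le_one h hγ0.le

lemma setLIntegral_ofReal_rpow {e t : ℝ} (he : -1 < e) (ht : 0 ≤ t) :
    ∫⁻ s in Ioc (0 : ℝ) t, ENNReal.ofReal (s ^ e) = ENNReal.ofReal (t ^ (e + 1) / (e + 1)) := by
  rw [← ofReal_integral_eq_lintegral_ofReal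
    ((intervalIntegrable_iff_integrableOn_Ioc_of_le ht).1
      (intervalIntegral.intervalIntegrable_rpow' he))
    (ae_restrict_of_forall_mem measurableSet_Ioc fun s hs ↦ Real.rpow_nonneg hs.1.le _),
    ← intervalIntegral.integral_of_le ht, integral_rpow (Or.inl he),
    Real.zero_rpow (by linarith), sub_zero]

lemma lintegral_gaussKer_mul_gaussKer_le {d : ℕ} {γ C : ℝ} (hC0 : 0 ≤ C)
    (hC : ∀ s : ℝ, 0 < s → ∀ y : ES d,
      ∫⁻ x : ES d, ENNReal.ofReal (gaussKer d (8 * s) x) * ‖x - y‖ₑ ^ (-γ) ≤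
        ENNReal.ofReal (C * s ^ (-γ / 2)))
    {s u : ℝ} (hs : 0 < s) (hu : 0 < u) :
    ∫⁻ x : ES d, ENNReal.ofReal (gaussKer d (8 * s) x) *
      ∫⁻ y : ES d, ENNReal.ofReal (gaussKer d (8 * u) y) * ‖y - x‖ₑ ^ (-γ) ≤
        ENNReal.ofReal (C * (s ^ (-γ / 4) * u ^ (-γ / 4))) := by
  have hg2 : ∀ r : ℝ, Measurable fun x : ES d ↦ ENNReal.ofReal (gaussKer d (8 * r) x) :=
    fun r ↦ (measurable_ofReal_gaussKer d).comp (measurable_const.prodMk measurable_id)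
  have key : ∀ s u : ℝ, 0 < s → 0 < u → ∫⁻ x : ES d, ENNReal.ofReal (gaussKer d (8 * s) x) *
      ∫⁻ y : ES d, ENNReal.ofReal (gaussKer d (8 * u) y) * ‖y - x‖ₑ ^ (-γ) ≤
        ENNReal.ofReal (C * u ^ (-γ / 2)) := by
    intro s u hs hu
    calc _ ≤ ∫⁻ x : ES d, ENNReal.ofReal (gaussKer d (8 * s) x) *
          ENNReal.ofReal (C * u ^ (-γ / 2)) := by
          gcongr with x
          exact hC u hu x
      _ = _ := by
          rw [lintegral_mul_const _ (hg2 s), lintegral_gaussKer d (by positivity), one_mul]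
  have hswap : ∫⁻ x : ES d, ENNReal.ofReal (gaussKer d (8 * s) x) *
      ∫⁻ y : ES d, ENNReal.ofReal (gaussKer d (8 * u) y) * ‖y - x‖ₑ ^ (-γ) =
      ∫⁻ y : ES d, ENNReal.ofReal (gaussKer d (8 * u) y) *
      ∫⁻ x : ES d, ENNReal.ofReal (gaussKer d (8 * s) x) * ‖x - y‖ₑ ^ (-γ) := by
    rw [lintegral_mul_lintegral_swap (k := fun y x : ES d ↦ ‖y - x‖ₑ ^ (-γ)) (hg2 u) (hg2 s)
      (by fun_prop)]
    simp_rw [enorm_sub_rev]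
  have hsplit : ∀ r : ℝ, 0 < r → r ^ (-γ / 2) = r ^ (-γ / 4) * r ^ (-γ / 4) := by
    intro r hr
    rw [← Real.rpow_add hr]
    ring_nf
  have hs0 := Real.rpow_nonneg hs.le (-γ / 4)
  have hu0 := Real.rpow_nonneg hu.le (-γ / 4)
  rcases le_total (s ^ (-γ / 4)) (u ^ (-γ / 4)) with h | h
  · rw [hswap]
    refine (key u s hu hs).trans (ENNReal.ofReal_le_ofReal ?_)
    rw [hsplit s hs]
    gcongr
  · refine (key s u hs hu).trans (ENNReal.ofReal_le_ofReal ?_)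
    rw [hsplit u hu]
    gcongr

/-- for d ≥ 3, α > 2 and 2 < γ < min(d,α,4), there is p₀ ∈ (1,10/9]
such that for every p ∈ (1,p₀) there is C = C(d,α,γ,p) with
∫∫ I_t(x) I_t(y) g(x,y) dx dy ≤ C t^(2+d−d/p−γ/2) for all t ≥ 1, for every Borel
g ≥ 0 with g(x,y) ≤ |x−y|^(−α) ∧ 1 (with the convention 0^(−α) = ∞, in ℝ≥0∞). -/
theorem double_integral_Ifun_g (d : ℕ) (hd : 3 ≤ d) (α γ : ℝ) (hα : 2 < α)
    (hγ1 : 2 < γ) (hγ2 : γ < min (min (d : ℝ) α) 4) :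
    ∃ p₀ : ℝ, 1 < p₀ ∧ p₀ ≤ 10 / 9 ∧ ∀ p : ℝ, 1 < p → p < p₀ →
      ∃ C : ℝ, ∀ g : EuclideanSpace ℝ (Fin d) → EuclideanSpace ℝ (Fin d) → ℝ,
        Measurable (Function.uncurry g) → (∀ x y, 0 ≤ g x y) →
        (∀ x y, ENNReal.ofReal (g x y) ≤ min ((‖x - y‖₊ : ℝ≥0∞) ^ (-α)) 1) →
        ∀ t : ℝ, 1 ≤ t →
          (∫⁻ x : EuclideanSpace ℝ (Fin d), ∫⁻ y : EuclideanSpace ℝ (Fin d),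
            ENNReal.ofReal (Ifun d p t x * Ifun d p t y * g x y)) ≤
          ENNReal.ofReal (C * t ^ (2 + (d : ℝ) - (d : ℝ) / p - γ / 2)) := by
  have hγd : γ < d := hγ2.trans_le ((min_le_left _ _).trans (min_le_left _ _))
  have hγα : γ < α := hγ2.trans_le ((min_le_left _ _).trans (min_le_right _ _))
  have hγ4 : γ < 4 := hγ2.trans_le (min_le_right _ _)
  have hγ0 : 0 < γ := by linarith
  obtain ⟨C, hC0, hC⟩ := exists_lintegral_gaussKer_mul_enorm_rpow_le d γ hγ0 hγd
  refine ⟨10 / 9, by norm_num, le_rfl, fun p hp _ ↦ ?_⟩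
  set δ : ℝ := (d : ℝ) / 2 - d / (2 * p) with hδ
  have hδ0 : 0 ≤ δ := by
    rw [hδ, sub_nonneg]
    gcongr
    linarith
  set e : ℝ := δ + -γ / 4 with he
  have he1 : -1 < e := by linarith
  refine ⟨C * (1 / (e + 1)) ^ 2, fun g _ _ hg t ht ↦ ?_⟩
  have ht0 : 0 < t := by linarith
  let Φ : (ES d) → ℝ≥0∞ := fun x ↦ ∫⁻ y, heatPotential d δ t y * ‖y - x‖ₑ ^ (-γ)
  let k : ℝ → (ES d) → ℝ≥0∞ := fun u x ↦
    ∫⁻ y, ENNReal.ofReal (gaussKer d (8 * u) y) * ‖y - x‖ₑ ^ (-γ)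
  have hΦm : Measurable Φ := by
    refine Measurable.lintegral_prod_right' (f := fun q : (ES d) × (ES d) ↦
      heatPotential d δ t q.2 * ‖q.2 - q.1‖ₑ ^ (-γ)) ?_
    exact ((measurable_heatPotential d δ t).comp measurable_snd).mul (by fun_prop)
  have hkm : Measurable (Function.uncurry k) := by
    refine Measurable.lintegral_prod_right' (f := fun q : (ℝ × (ES d)) × (ES d) ↦
      ENNReal.ofReal (gaussKer d (8 * q.1.1) q.2) * ‖q.2 - q.1.2‖ₑ ^ (-γ)) ?_
    exact ((measurable_ofReal_gaussKer d).comp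
      (measurable_fst.fst.prodMk measurable_snd)).mul (by fun_prop)
  have hΦ : ∀ x, Φ x = ∫⁻ u in Ioc (0 : ℝ) t, ENNReal.ofReal (u ^ δ) * k u x := fun x ↦
    lintegral_heatPotential_mul d δ t (by fun_prop)
  have hpow : ∀ s : ℝ, 0 < s → s ^ δ * s ^ (-γ / 4) = s ^ e := fun s hs ↦
    (Real.rpow_add hs _ _).symm
  have hgs : ∀ s : ℝ, Measurable fun x : ES d ↦ ENNReal.ofReal (gaussKer d (8 * s) x) :=
    fun s ↦ (measurable_ofReal_gaussKer d).comp (measurable_const.prodMk measurable_id)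
  have hinner : ∀ s ∈ Ioc (0 : ℝ) t, ENNReal.ofReal (s ^ δ) *
      ∫⁻ x, ENNReal.ofReal (gaussKer d (8 * s) x) * Φ x ≤
      ENNReal.ofReal (s ^ e) * ENNReal.ofReal (C * (t ^ (e + 1) / (e + 1))) := by
    intro s hs
    have hs0 := hs.1
    have h1 : ∫⁻ x, ENNReal.ofReal (gaussKer d (8 * s) x) * Φ x =
        ∫⁻ u in Ioc (0 : ℝ) t, ENNReal.ofReal (u ^ δ) *
          ∫⁻ x, ENNReal.ofReal (gaussKer d (8 * s) x) * k u x := by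
      simp_rw [hΦ]
      exact lintegral_mul_lintegral_swap (by fun_prop) (hgs s) hkm
    have h2 : ∫⁻ x, ENNReal.ofReal (gaussKer d (8 * s) x) * Φ x ≤
        ENNReal.ofReal (C * s ^ (-γ / 4)) * ENNReal.ofReal (t ^ (e + 1) / (e + 1)) := by
      rw [h1, ← setLIntegral_ofReal_rpow he1 ht0.le, ← lintegral_const_mul _ (by fun_prop)]
      refine setLIntegral_mono' measurableSet_Ioc fun u hu ↦ ?_
      have hu0 := hu.1
      calc _ ≤ ENNReal.ofReal (u ^ δ) * ENNReal.ofReal (C * (s ^ (-γ / 4) * u ^ (-γ / 4))) := by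
            gcongr
            exact lintegral_gaussKer_mul_gaussKer_le hC0 hC hs0 hu0
        _ = _ := by
            rw [← ENNReal.ofReal_mul (by positivity), ← ENNReal.ofReal_mul (by positivity),
              ← hpow u hu0]
            ring_nf
    calc _ ≤ ENNReal.ofReal (s ^ δ) * (ENNReal.ofReal (C * s ^ (-γ / 4)) *
          ENNReal.ofReal (t ^ (e + 1) / (e + 1))) := by gcongr
      _ = _ := by
          rw [← ENNReal.ofReal_mul (by positivity), ← ENNReal.ofReal_mul (by positivity),
            ← ENNReal.ofReal_mul (by positivity), ← hpow s hs0]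
          ring_nf
  have hI0 : ∀ x, 0 ≤ Ifun d p t x := fun x ↦ le_min zero_le_one
    (setIntegral_nonneg measurableSet_Ioc fun s hs ↦ mul_nonneg (Real.rpow_nonneg hs.1.le _)
      (gaussKer_nonneg d (by linarith [hs.1]) x))
  calc _ ≤ ∫⁻ x, heatPotential d δ t x * Φ x := by
        refine lintegral_mono fun x ↦ ?_
        rw [← lintegral_const_mul (heatPotential d δ t x)
          (f := fun y ↦ heatPotential d δ t y * ‖y - x‖ₑ ^ (-γ))
          ((measurable_heatPotential d δ t).mul (by fun_prop))]
        refine lintegral_mono fun y ↦ ?_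
        rw [ENNReal.ofReal_mul (mul_nonneg (hI0 x) (hI0 y)), ENNReal.ofReal_mul (hI0 x), mul_assoc]
        gcongr
        · exact ofReal_Ifun_le d p t x
        · exact ofReal_Ifun_le d p t y
        · rw [enorm_sub_rev]
          exact (hg x y).trans (min_rpow_neg_le α γ hγ0 hγα.le _)
    _ ≤ ∫⁻ s in Ioc (0 : ℝ) t,
          ENNReal.ofReal (s ^ e) * ENNReal.ofReal (C * (t ^ (e + 1) / (e + 1))) := by
        rw [lintegral_heatPotential_mul d δ t hΦm]
        exact setLIntegral_mono' measurableSet_Ioc hinner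
    _ = _ := by
        have he0 : 0 < e + 1 := by linarith
        have hexp : 2 + (d : ℝ) - d / p - γ / 2 = (e + 1) + (e + 1) := by
          have hp0 : p ≠ 0 := by linarith
          rw [he, hδ]
          field_simp
          ring
        rw [lintegral_mul_const _ (by fun_prop), setLIntegral_ofReal_rpow he1 ht0.le,
          ← ENNReal.ofReal_mul (by positivity), hexp, Real.rpow_add ht0 (e + 1) (e + 1)]
        generalize t ^ (e + 1) = T
        congr 1
        ring
end
end

section
/- Let d ∈ {3,4} and p ∈ (1, 10/9). There exists a constant C = C(d,p) such that for all t ≥ 0, ∫_{ℝ^d} I_t(x)² dx ≤ C · (max(t,1))^{2 + d/2 − d/p}. -/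
open MeasureTheory ProbabilityTheory Set
open scoped ENNReal NNReal

noncomputable section

/-- Cauchy-Schwarz for the lower Lebesgue integral. -/
theorem lintegral_mul_sq_le {α : Type*} [MeasurableSpace α] (μ : Measure α) {f g : α → ℝ≥0∞}
    (hf : AEMeasurable f μ) (hg : AEMeasurable g μ) :
    (∫⁻ a, f a * g a ∂μ) ^ 2 ≤ (∫⁻ a, f a ^ 2 ∂μ) * ∫⁻ a, g a ^ 2 ∂μ := by
  have h := ENNReal.lintegral_mul_le_Lp_mul_Lq μ Real.HolderConjugate.two_two hf hg
  have h2 := pow_le_pow_left' h 2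
  simp only [Pi.mul_apply, ENNReal.rpow_two] at h2
  refine h2.trans_eq ?_
  rw [mul_pow, ← ENNReal.rpow_natCast, ← ENNReal.rpow_natCast, ← ENNReal.rpow_mul,
    ← ENNReal.rpow_mul]
  norm_num

theorem setLIntegral_Ioc_rpow {γ t : ℝ} (hγ : -1 < γ) (ht : 0 ≤ t) :
    ∫⁻ s in Ioc (0 : ℝ) t, ENNReal.ofReal (s ^ γ) = ENNReal.ofReal (t ^ (γ + 1) / (γ + 1)) := by
  have hi : IntegrableOn (fun s : ℝ ↦ s ^ γ) (Ioc 0 t) :=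
    (intervalIntegrable_iff_integrableOn_Ioc_of_le ht).1
      (intervalIntegral.intervalIntegrable_rpow' hγ)
  rw [← ofReal_integral_eq_lintegral_ofReal hi, ← intervalIntegral.integral_of_le ht,
    integral_rpow (Or.inl hγ), Real.zero_rpow (by linarith), sub_zero]
  filter_upwards [ae_restrict_mem measurableSet_Ioc] with s hs
  exact Real.rpow_nonneg hs.1.le _

theorem lintegral_exp_neg_mul_norm_sq (d : ℕ) {b : ℝ} (hb : 0 < b) :
    ∫⁻ x : EuclideanSpace ℝ (Fin d), ENNReal.ofReal (Real.exp (-b * ‖x‖ ^ 2)) =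
      ENNReal.ofReal ((Real.pi / b) ^ ((d : ℝ) / 2)) := by
  have h := GaussianFourier.integral_rexp_neg_mul_sq_norm (V := EuclideanSpace ℝ (Fin d)) hb
  rw [finrank_euclideanSpace_fin] at h
  rw [← h, ofReal_integral_eq_lintegral_ofReal]
  · refine Integrable.of_integral_ne_zero ?_
    rw [h]
    positivity
  · exact Filter.Eventually.of_forall fun x ↦ (Real.exp_pos _).le

theorem measurable_gaussKer_mul (d : ℕ) (c : ℝ) :
    Measurable fun z : ℝ × EuclideanSpace ℝ (Fin d) ↦ gaussKer d (c * z.1) z.2 := by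
  unfold gaussKer
  fun_prop

theorem lintegral_sq_rpow_mul_gaussKer (d : ℕ) (β c : ℝ) (hc : 0 < c) {s : ℝ} (hs : 0 < s) :
    ∫⁻ x : EuclideanSpace ℝ (Fin d), ENNReal.ofReal ((s ^ β * gaussKer d (c * s) x) ^ 2) =
      ENNReal.ofReal ((4 * Real.pi * c) ^ (-(d : ℝ) / 2) * s ^ (2 * β - d / 2)) := by
  have hpi := Real.pi_pos
  have hx (x : EuclideanSpace ℝ (Fin d)) :
      ENNReal.ofReal ((s ^ β * gaussKer d (c * s) x) ^ 2) =
        ENNReal.ofReal ((s ^ β * (2 * Real.pi * (c * s)) ^ (-(d : ℝ) / 2)) ^ 2) *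
          ENNReal.ofReal (Real.exp (-(1 / (c * s)) * ‖x‖ ^ 2)) := by
    rw [← ENNReal.ofReal_mul (by positivity)]
    congr 1
    rw [gaussKer, ← mul_assoc, mul_pow, ← Real.exp_nat_mul]
    congr 2
    field_simp
    norm_num [mul_comm]
  simp_rw [hx]
  rw [lintegral_const_mul _ (by fun_prop), lintegral_exp_neg_mul_norm_sq d (by positivity),
    ← ENNReal.ofReal_mul (by positivity)]
  congr 1
  have e1 : Real.pi / (1 / (c * s)) = Real.exp (Real.log Real.pi + Real.log c + Real.log s) := by
    rw [Real.exp_add, Real.exp_add, Real.exp_log hpi, Real.exp_log hc, Real.exp_log hs]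
    field_simp
  rw [e1, ← Real.exp_mul]
  rw [Real.rpow_def_of_pos hs, Real.rpow_def_of_pos hs, Real.rpow_def_of_pos (by positivity),
    Real.rpow_def_of_pos (by positivity), ← Real.exp_add, ← Real.exp_nat_mul, ← Real.exp_add,
    ← Real.exp_add, Real.log_mul (by positivity) (by positivity),
    Real.log_mul (by positivity) (by positivity), Real.log_mul (by positivity) (by positivity),
    Real.log_mul (by positivity) (by positivity), Real.log_mul (by positivity) (by positivity),
    show (4 : ℝ) = 2 ^ 2 by norm_num, Real.log_pow]
  congr 1
  push_cast
  ring

theorem ofReal_Ifun_sq_le (d : ℕ) (p t : ℝ) (x : EuclideanSpace ℝ (Fin d)) :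
    ENNReal.ofReal (Ifun d p t x ^ 2) ≤
      (∫⁻ s in Ioc (0 : ℝ) t,
        ENNReal.ofReal (s ^ ((d : ℝ) / 2 - (d : ℝ) / (2 * p)) * gaussKer d (8 * s) x)) ^ 2 := by
  have hF : ∀ s ∈ Ioc (0 : ℝ) t,
      0 ≤ s ^ ((d : ℝ) / 2 - (d : ℝ) / (2 * p)) * gaussKer d (8 * s) x := fun s hs ↦ by
    have := hs.1
    unfold gaussKer
    positivity
  have hJ := setIntegral_nonneg (μ := volume) measurableSet_Ioc hF
  rw [Ifun, ENNReal.ofReal_pow (le_min zero_le_one hJ)]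
  refine pow_le_pow_left' ((ENNReal.ofReal_le_ofReal (min_le_right _ _)).trans ?_) 2
  rw [← Real.enorm_eq_ofReal hJ]
  refine (enorm_integral_le_lintegral_enorm _).trans_eq ?_
  exact setLIntegral_congr_fun measurableSet_Ioc fun s hs ↦ Real.enorm_eq_ofReal (hF s hs)

theorem lintegral_Ifun_sq_le (d : ℕ) (p t : ℝ) (ht : 0 ≤ t)
    (hp : -1 < (d : ℝ) / 4 - d / (2 * p)) :
    ∫⁻ x : EuclideanSpace ℝ (Fin d), ENNReal.ofReal (Ifun d p t x ^ 2) ≤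
      ENNReal.ofReal ((4 * Real.pi * 8) ^ (-(d : ℝ) / 2)) *
        ENNReal.ofReal (t ^ ((d : ℝ) / 4 - d / (2 * p) + 1) / (d / 4 - d / (2 * p) + 1)) ^ 2 := by
  set β : ℝ := (d : ℝ) / 2 - d / (2 * p) with hβ
  set γ : ℝ := (d : ℝ) / 4 - d / (2 * p) with hγ
  let g (s : ℝ) (x : EuclideanSpace ℝ (Fin d)) : ℝ≥0∞ :=
    ENNReal.ofReal (s ^ (β - γ / 2) * gaussKer d (8 * s) x)
  have hg : Measurable (Function.uncurry g) := by
    have := measurable_gaussKer_mul d 8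
    simp only [g, Function.uncurry_def]
    fun_prop
  have hCS (x : EuclideanSpace ℝ (Fin d)) : ENNReal.ofReal (Ifun d p t x ^ 2) ≤
      (∫⁻ s in Ioc 0 t, ENNReal.ofReal (s ^ γ)) * ∫⁻ s in Ioc 0 t, g s x ^ 2 := by
    calc
      _ ≤ _ := ofReal_Ifun_sq_le d p t x
      _ = (∫⁻ s in Ioc 0 t, ENNReal.ofReal (s ^ (γ / 2)) * g s x) ^ 2 := by
        congr 1
        refine setLIntegral_congr_fun measurableSet_Ioc fun s hs ↦ ?_
        have hs0 : 0 < s := hs.1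
        simp only [g]
        rw [← ENNReal.ofReal_mul (by positivity), ← mul_assoc, ← Real.rpow_add hs0]
        congr 3
        ring
      _ ≤ (∫⁻ s in Ioc 0 t, ENNReal.ofReal (s ^ (γ / 2)) ^ 2) * ∫⁻ s in Ioc 0 t, g s x ^ 2 :=
        lintegral_mul_sq_le _ (by fun_prop) (hg.comp measurable_prodMk_right).aemeasurable
      _ = _ := by
        congr 1
        refine setLIntegral_congr_fun measurableSet_Ioc fun s hs ↦ ?_
        have hs0 : 0 < s := hs.1
        rw [← ENNReal.ofReal_pow (by positivity), ← Real.rpow_mul_natCast hs0.le]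
        congr 2
        push_cast
        ring
  have hswap : ∫⁻ x, ∫⁻ s in Ioc 0 t, g s x ^ 2 =
      ENNReal.ofReal ((4 * Real.pi * 8) ^ (-(d : ℝ) / 2)) *
        ∫⁻ s in Ioc 0 t, ENNReal.ofReal (s ^ γ) := by
    rw [← lintegral_lintegral_swap (hg.pow_const 2).aemeasurable,
      ← lintegral_const_mul _ (by fun_prop)]
    refine setLIntegral_congr_fun measurableSet_Ioc fun s hs ↦ ?_
    have hs0 : 0 < s := hs.1
    have hsq (x : EuclideanSpace ℝ (Fin d)) :
        g s x ^ 2 = ENNReal.ofReal ((s ^ (β - γ / 2) * gaussKer d (8 * s) x) ^ 2) := by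
      rw [ENNReal.ofReal_pow]
      unfold gaussKer
      positivity
    simp only [hsq]
    rw [lintegral_sq_rpow_mul_gaussKer d _ 8 (by norm_num) hs0, ENNReal.ofReal_mul (by positivity)]
    congr 3
    rw [hβ, hγ]
    ring
  have hm : Measurable fun x ↦ ∫⁻ s in Ioc 0 t, g s x ^ 2 :=
    (hg.pow_const 2).lintegral_prod_left'
  calc
    _ ≤ _ := lintegral_mono hCS
    _ = _ := by
      rw [lintegral_const_mul _ hm, hswap, setLIntegral_Ioc_rpow hp ht]
      ring

/-- for d ∈ {3,4} and p ∈ (1,10/9), there is C = C(d,p) with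
∫ I_t(x)² dx ≤ C (t ∨ 1)^{2 + d/2 − d/p} for all t ≥ 0. -/
theorem integral_Ifun_sq (d : ℕ) (hd : d = 3 ∨ d = 4) (p : ℝ)
    (hp1 : 1 < p) (hp2 : p < 10 / 9) :
    ∃ C : ℝ, ∀ t : ℝ, 0 ≤ t →
      (∫⁻ x : EuclideanSpace ℝ (Fin d), ENNReal.ofReal (Ifun d p t x ^ 2)) ≤
      ENNReal.ofReal (C * max t 1 ^ (2 + (d : ℝ) / 2 - (d : ℝ) / p)) := by
  have hp0 : 0 < p := by linarith
  have hγ : -1 < (d : ℝ) / 4 - d / (2 * p) := by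
    have hlt : (d : ℝ) / (2 * p) < d / 2 :=
      div_lt_div_of_pos_left (by rcases hd with rfl | rfl <;> norm_num) two_pos (by linarith)
    have hd4 : (d : ℝ) ≤ 4 := by rcases hd with rfl | rfl <;> norm_num
    linarith
  have hexp : 2 + (d : ℝ) / 2 - d / p = ((d : ℝ) / 4 - d / (2 * p) + 1) * (2 : ℕ) := by
    field_simp
    push_cast
    ring
  set γ : ℝ := (d : ℝ) / 4 - d / (2 * p)
  have hγ1 : 0 < γ + 1 := by linarith
  refine ⟨(4 * Real.pi * 8) ^ (-(d : ℝ) / 2) / (γ + 1) ^ 2, fun t ht ↦ ?_⟩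
  refine (lintegral_Ifun_sq_le d p t ht hγ).trans ?_
  have hpi := Real.pi_pos
  rw [← ENNReal.ofReal_pow (by positivity), ← ENNReal.ofReal_mul (by positivity), hexp,
    Real.rpow_mul_natCast (by positivity), div_pow, mul_div_assoc', div_mul_eq_mul_div]
  gcongr
  exact le_max_left _ _
end
end
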